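/- For every submodular–concave game (f, [n], Y) with f continuous in y, the mixed value V^{mix} := min_{μ ∈ Δ(2^{[n]})} max_{y ∈ Y} E_{S∼μ}[f(S,y)] and the relaxed value V^{⋆} := min_{x ∈ [0,1]^n} max_{y ∈ Y} f_L(x,y) are equal: V^{⋆} = V^{mix}. -/

import Mathlib

open scoped BigOperators

noncomputable section

/-- Submodularity of a set function on the ground set `Fin n`. -/
def Submodular {n : ℕ} (f : Finset (Fin n) → ℝ) : Prop :=
  ∀ S T : Finset (Fin n), f (S ∪ T) + f (S ∩ T) ≤ f S + f T

/-- The chain set `C_i = {σ(0), …, σ(i-1)}` determined by a permutation `σ`. -/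
def chainOf {n : ℕ} (σ : Equiv.Perm (Fin n)) (i : ℕ) : Finset (Fin n) :=
  (Finset.univ.filter fun k : Fin n => (k : ℕ) < i).image σ

/-- The permutation sorting `x` in descending order (deterministic tie-breaking). -/
def sortPerm {n : ℕ} (x : Fin n → ℝ) : Equiv.Perm (Fin n) :=
  Tuple.sort (fun i => -x i)

/-- Sorted values `x_{π(i)}`, with the conventions `x_{π(0)} = 1` and `x_{π(n+1)} = 0`. -/
def sortedVal {n : ℕ} (x : Fin n → ℝ) (i : ℕ) : ℝ :=
  if _h0 : i = 0 then 1
  else if h : i ≤ n then x (sortPerm x ⟨i - 1, by omega⟩) else 0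

/-- The Lovász extension `f_L(x) = ∑_{i=0}^n (x_{π(i)} − x_{π(i+1)}) f(C_i)`. -/
def lovasz {n : ℕ} (f : Finset (Fin n) → ℝ) (x : Fin n → ℝ) : ℝ :=
  ∑ i ∈ Finset.range (n + 1),
    (sortedVal x i - sortedVal x (i + 1)) * f (chainOf (sortPerm x) i)

/-- Two-argument Lovász extension of a payoff `f : 2^{[n]} × Y → ℝ`. -/
def lovaszG {n m : ℕ} (f : Finset (Fin n) → (Fin m → ℝ) → ℝ)
    (x : Fin n → ℝ) (y : Fin m → ℝ) : ℝ :=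
  lovasz (fun S => f S y) x

/-- The unit cube `[0,1]^n`. -/
def cube (n : ℕ) : Set (Fin n → ℝ) := Set.Icc (0 : Fin n → ℝ) 1

theorem chainOf_zero {n : ℕ} (σ : Equiv.Perm (Fin n)) : chainOf σ 0 = ∅ := by
  simp [chainOf]

theorem chainOf_self {n : ℕ} (σ : Equiv.Perm (Fin n)) : chainOf σ n = Finset.univ := by
  ext j
  simp [chainOf]

theorem mem_chainOf {n : ℕ} (σ : Equiv.Perm (Fin n)) (i : ℕ) (j : Fin n) :
    σ j ∈ chainOf σ i ↔ (j : ℕ) < i := by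
  simp [chainOf]

theorem chainOf_succ {n : ℕ} (σ : Equiv.Perm (Fin n)) (i : Fin n) :
    chainOf σ (i + 1) = insert (σ i) (chainOf σ i) := by
  ext j
  obtain ⟨k, rfl⟩ := σ.surjective j
  simp only [Finset.mem_insert, mem_chainOf, σ.injective.eq_iff, Fin.ext_iff]
  omega

/-- The greedy vector along any chain lies in the base polyhedron of a submodular function. -/
theorem Submodular.greedy_le {n : ℕ} {f : Finset (Fin n) → ℝ} (hf : Submodular f)
    (σ : Equiv.Perm (Fin n)) (S : Finset (Fin n)) :
    f ∅ + ∑ i : Fin n, (if σ i ∈ S then 1 else 0) *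
      (f (chainOf σ (i + 1)) - f (chainOf σ i)) ≤ f S := by
  have step (i : Fin n) : (if σ i ∈ S then 1 else 0) *
      (f (chainOf σ (i + 1)) - f (chainOf σ i)) ≤
        f (S ∩ chainOf σ (i + 1)) - f (S ∩ chainOf σ i) := by
    have hmem : σ i ∉ chainOf σ i := by simp [mem_chainOf]
    rw [chainOf_succ]
    split_ifs with h
    · have key := hf (S ∩ insert (σ i) (chainOf σ i)) (chainOf σ i)
      have hu : S ∩ insert (σ i) (chainOf σ i) ∪ chainOf σ i = insert (σ i) (chainOf σ i) := by
        ext j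
        simp only [Finset.mem_union, Finset.mem_inter, Finset.mem_insert]
        grind
      have hi : S ∩ insert (σ i) (chainOf σ i) ∩ chainOf σ i = S ∩ chainOf σ i := by
        ext j
        simp only [Finset.mem_inter, Finset.mem_insert]
        grind
      rw [hu, hi] at key
      linarith
    · rw [Finset.inter_insert_of_notMem h]
      simp
  have htel : ∑ i : Fin n, (f (S ∩ chainOf σ (i + 1)) - f (S ∩ chainOf σ i)) = f S - f ∅ := by
    rw [Fin.sum_univ_eq_sum_range
      (fun i => f (S ∩ chainOf σ (i + 1)) - f (S ∩ chainOf σ i)) n,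
      Finset.sum_range_sub (fun i => f (S ∩ chainOf σ i))]
    simp [chainOf_zero, chainOf_self]
  have := Finset.sum_le_sum fun i (_ : i ∈ Finset.univ) => step i
  linarith

theorem sortedVal_zero {n : ℕ} (x : Fin n → ℝ) : sortedVal x 0 = 1 := by
  simp [sortedVal]

theorem sortedVal_succ {n : ℕ} (x : Fin n → ℝ) (i : Fin n) :
    sortedVal x (i + 1) = x (sortPerm x i) := by
  simp [sortedVal, Nat.succ_le_of_lt i.isLt]

theorem sortedVal_self_add_one {n : ℕ} (x : Fin n → ℝ) : sortedVal x (n + 1) = 0 := by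
  simp [sortedVal]

/-- Summation by parts for sums of decrements against a sequence. -/
theorem sum_range_decrement_mul (v g : ℕ → ℝ) (k : ℕ) :
    ∑ i ∈ Finset.range (k + 1), (v i - v (i + 1)) * g i =
      v 0 * g 0 - v (k + 1) * g k +
        ∑ i ∈ Finset.range k, v (i + 1) * (g (i + 1) - g i) := by
  induction k with
  | zero => simp [sub_mul]
  | succ k ih => rw [Finset.sum_range_succ, ih, Finset.sum_range_succ]; ring

theorem lovasz_eq_greedy {n : ℕ} (f : Finset (Fin n) → ℝ) (x : Fin n → ℝ) :
    lovasz f x = f ∅ + ∑ i : Fin n, x (sortPerm x i) *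
      (f (chainOf (sortPerm x) (i + 1)) - f (chainOf (sortPerm x) i)) := by
  rw [lovasz, sum_range_decrement_mul (sortedVal x) (fun i => f (chainOf (sortPerm x) i)),
    ← Fin.sum_univ_eq_sum_range (fun i => sortedVal x (i + 1) *
      (f (chainOf (sortPerm x) (i + 1)) - f (chainOf (sortPerm x) i))) n]
  simp [sortedVal_zero, sortedVal_self_add_one, sortedVal_succ, chainOf_zero]

theorem sortedVal_succ_le {n : ℕ} {x : Fin n → ℝ} (hx : x ∈ cube n) {i : ℕ} (hi : i ≤ n) :
    sortedVal x (i + 1) ≤ sortedVal x i := by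
  have hnonneg (j : Fin n) : 0 ≤ x j := hx.1 j
  have hle (j : Fin n) : x j ≤ 1 := hx.2 j
  rcases hi.eq_or_lt with rfl | hlt
  · rw [sortedVal_self_add_one]
    unfold sortedVal
    split_ifs
    exacts [zero_le_one, hnonneg _]
  · rw [sortedVal_succ x ⟨i, hlt⟩]
    rcases i with _ | i
    · rw [sortedVal_zero]
      exact hle _
    · rw [sortedVal_succ x ⟨i, by omega⟩]
      have hmono : Monotone ((fun j => -x j) ∘ sortPerm x) := Tuple.monotone_sort _
      have := hmono (show (⟨i, by omega⟩ : Fin n) ≤ ⟨i + 1, hlt⟩ from Nat.le_succ i)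
      simpa using this

/-- The law of the upper level sets of `x` at a uniformly random threshold. -/
def thresholdLaw {n : ℕ} (x : Fin n → ℝ) (S : Finset (Fin n)) : ℝ :=
  ∑ i ∈ Finset.range (n + 1),
    if chainOf (sortPerm x) i = S then sortedVal x i - sortedVal x (i + 1) else 0

theorem sum_thresholdLaw_mul {n : ℕ} (f : Finset (Fin n) → ℝ) (x : Fin n → ℝ) :
    ∑ S, thresholdLaw x S * f S = lovasz f x := by
  simp only [thresholdLaw, Finset.sum_mul, lovasz]
  rw [Finset.sum_comm]
  simp

theorem thresholdLaw_mem_stdSimplex {n : ℕ} {x : Fin n → ℝ} (hx : x ∈ cube n) :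
    thresholdLaw x ∈ stdSimplex ℝ (Finset (Fin n)) := by
  refine ⟨fun S => Finset.sum_nonneg fun i hi => ?_, ?_⟩
  · have := sortedVal_succ_le hx (Nat.lt_succ_iff.mp (Finset.mem_range.mp hi))
    split_ifs <;> linarith
  · have := sum_thresholdLaw_mul (fun _ => 1) x
    simpa [lovasz_eq_greedy] using this

/-- The vector of inclusion probabilities of a weight function on subsets. -/
def marginal {n : ℕ} (μ : Finset (Fin n) → ℝ) (j : Fin n) : ℝ :=
  ∑ S, μ S * if j ∈ S then 1 else 0

theorem marginal_mem_cube {n : ℕ} {μ : Finset (Fin n) → ℝ}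
    (hμ : μ ∈ stdSimplex ℝ (Finset (Fin n))) : marginal μ ∈ cube n := by
  refine ⟨fun j => Finset.sum_nonneg fun S _ => mul_nonneg (hμ.1 S) ?_, fun j => ?_⟩
  · split_ifs <;> norm_num
  · rw [Pi.one_apply, ← hμ.2]
    refine Finset.sum_le_sum fun S _ => mul_le_of_le_one_right (hμ.1 S) ?_
    split_ifs <;> norm_num

/-- Among all distributions with given marginals, the threshold law minimizes the expectation of a
submodular function. -/
theorem Submodular.lovasz_marginal_le {n : ℕ} {f : Finset (Fin n) → ℝ} (hf : Submodular f)
    {μ : Finset (Fin n) → ℝ} (hμ : μ ∈ stdSimplex ℝ (Finset (Fin n))) :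
    lovasz f (marginal μ) ≤ ∑ S, μ S * f S := by
  have hle := Finset.sum_le_sum fun S (_ : S ∈ Finset.univ) =>
    mul_le_mul_of_nonneg_left (hf.greedy_le (sortPerm (marginal μ)) S) (hμ.1 S)
  refine le_of_eq_of_le ?_ hle
  simp only [mul_add, Finset.sum_add_distrib, ← Finset.sum_mul, hμ.2, one_mul, lovasz_eq_greedy,
    Finset.mul_sum]
  rw [Finset.sum_comm]
  congr 1
  refine Finset.sum_congr rfl fun i _ => ?_
  simp only [← mul_assoc, ← Finset.sum_mul, marginal]

/-- Mixed minimax value via threshold coupling.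
For a submodular–concave game `(f, [n], Y)` with `f` continuous in `y`, the relaxed value
`V⋆ = min_{x ∈ [0,1]^n} max_{y ∈ Y} f_L(x,y)` equals the mixed value
`V^mix = min_{μ ∈ Δ(2^{[n]})} max_{y ∈ Y} E_{S∼μ}[f(S,y)]`. -/
theorem relaxed_value_eq_mixed_value {n m : ℕ} (hn : 1 ≤ n)
    (Y : Set (Fin m → ℝ)) (hYcomp : IsCompact Y) (hYconv : Convex ℝ Y)
    (hYne : Y.Nonempty)
    (f : Finset (Fin n) → (Fin m → ℝ) → ℝ)
    (hsub : ∀ y ∈ Y, Submodular (fun S => f S y))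
    (hconc : ∀ S : Finset (Fin n), ConcaveOn ℝ Y (f S))
    (hcont : ∀ S : Finset (Fin n), ContinuousOn (f S) Y) :
    sInf ((fun x => sSup ((fun y => lovaszG f x y) '' Y)) '' cube n)
      = sInf ((fun μ => sSup ((fun y => ∑ S : Finset (Fin n), μ S * f S y) '' Y)) ''
          stdSimplex ℝ (Finset (Fin n))) := by
  have hbdd (μ : Finset (Fin n) → ℝ) :
      BddAbove ((fun y => ∑ S : Finset (Fin n), μ S * f S y) '' Y) :=
    hYcomp.bddAbove_image
      (continuousOn_finsetSum _ fun S _ => continuousOn_const.mul (hcont S))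
  have heq (x : Fin n → ℝ) :
      (fun y => ∑ S, thresholdLaw x S * f S y) = fun y => lovaszG f x y :=
    funext fun y => sum_thresholdLaw_mul (fun S => f S y) x
  have hsubset : (fun x => sSup ((fun y => lovaszG f x y) '' Y)) '' cube n ⊆
      (fun μ => sSup ((fun y => ∑ S : Finset (Fin n), μ S * f S y) '' Y)) ''
        stdSimplex ℝ (Finset (Fin n)) := by
    rintro _ ⟨x, hx, rfl⟩
    exact ⟨thresholdLaw x, thresholdLaw_mem_stdSimplex hx, by simp only [heq]⟩
  have hbelow : BddBelow ((fun μ => sSup ((fun y => ∑ S : Finset (Fin n), μ S * f S y) '' Y)) ''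
      stdSimplex ℝ (Finset (Fin n))) := by
    obtain ⟨y, hy⟩ := hYne
    refine ((isCompact_stdSimplex ℝ (Finset (Fin n))).bddBelow_image
      (f := fun μ => ∑ S, μ S * f S y) (by fun_prop)).imp fun b hb => ?_
    rintro _ ⟨μ, hμ, rfl⟩
    exact (hb ⟨μ, hμ, rfl⟩).trans (le_csSup (hbdd μ) ⟨y, hy, rfl⟩)
  have hcube : (cube n).Nonempty := ⟨0, le_rfl, zero_le_one⟩
  have hne := hcube.image fun x => sSup ((fun y => lovaszG f x y) '' Y)
  refine le_antisymm (le_csInf (hne.mono hsubset) ?_) (csInf_le_csInf hbelow hne hsubset)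
  rintro _ ⟨μ, hμ, rfl⟩
  refine (csInf_le (hbelow.mono hsubset) ⟨marginal μ, marginal_mem_cube hμ, rfl⟩).trans ?_
  refine csSup_le (hYne.image _) ?_
  rintro _ ⟨y, hy, rfl⟩
  exact ((hsub y hy).lovasz_marginal_le hμ).trans (le_csSup (hbdd μ) ⟨y, hy, rfl⟩)

end
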